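/- Let H be a finite-dimensional real inner product space, J a complex structure on H (J* = -J, J² = -I), and O an orthogonal operator on H. Define Ind(J, O*JO) = (1/2)·dim ker(J + O*JO) mod 2. Then (-1)^{Ind(J, O*JO)} = det(O). -/

import Mathlib

open Module
open scoped RealInnerProductSpace

/-- A real endomorphism commuting with a complex structure has nonnegative determinant. -/
theorem LinearMap.det_nonneg_of_commute_complexStructure {V : Type*} [AddCommGroup V] [Module ℝ V]
    {J A : V →ₗ[ℝ] V} (hJ : J * J = -1) (hA : Commute A J) : 0 ≤ LinearMap.det A := by
  let _ : Module ℂ V := Module.compHom V (Complex.liftAux (A := Module.End ℝ V) J hJ).toRingHom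
  have hsmul (z : ℂ) (v : V) : z • v = z.re • v + z.im • J v := by
    change (Complex.liftAux (A := Module.End ℝ V) J hJ z) v = _
    simp [Complex.liftAux_apply]
  have : IsScalarTower ℝ ℂ V := ⟨fun r z v ↦ by simp [hsmul, mul_smul]⟩
  let A' : V →ₗ[ℂ] V :=
    { toFun := A
      map_add' := map_add A
      map_smul' := fun z v ↦ by
        have : A (J v) = J (A v) := LinearMap.congr_fun hA v
        simp [hsmul, this] }
  have hdet : LinearMap.det A = Algebra.norm ℝ (LinearMap.det A') :=
    LinearMap.det_restrictScalars (R := ℝ) (f := A')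
  rw [hdet, Algebra.norm_complex_apply]
  exact Complex.normSq_nonneg _

section

variable {H : Type*} [NormedAddCommGroup H] [InnerProductSpace ℝ H]
  {J O : H →ₗ[ℝ] H}

/-- If `A x` and `B x` are always orthogonal and `A` has positive determinant,
then `A + B` has positive determinant. -/
theorem LinearMap.det_add_pos_of_inner_eq_zero [FiniteDimensional ℝ H] {A B : H →ₗ[ℝ] H}
    (hAB : ∀ x, ⟪A x, B x⟫ = 0) (hA : 0 < LinearMap.det A) : 0 < LinearMap.det (A + B) := by
  have hinj : LinearMap.ker A = ⊥ := by
    by_contra h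
    exact hA.ne' (LinearMap.det_eq_zero_iff_ker_ne_bot.2 h)
  let f : ℝ → ℝ := fun t ↦ LinearMap.det (A + t • B)
  have hf : Continuous f := by
    have h : Continuous fun t : ℝ ↦
        (LinearMap.toContinuousLinearMap A + t • LinearMap.toContinuousLinearMap B).det :=
      ContinuousLinearMap.continuous_det.comp (by fun_prop)
    exact h
  have hne (t : ℝ) : f t ≠ 0 := by
    intro h
    refine LinearMap.det_eq_zero_iff_ker_ne_bot.1 h ((Submodule.eq_bot_iff _).2 fun x hx ↦ ?_)
    have hx' : A x + t • B x = 0 := hx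
    have h0 : ⟪A x, A x + t • B x⟫ = 0 := by rw [hx', inner_zero_right]
    rw [inner_add_right, inner_smul_right, hAB, mul_zero, add_zero, inner_self_eq_zero] at h0
    exact (Submodule.eq_bot_iff _).1 hinj x h0
  by_contra! h
  have h1 : f 1 ≤ 0 := by simpa [f] using h
  have h0 : 0 ≤ f 0 := by simpa [f] using hA.le
  obtain ⟨t, ht⟩ := mem_range_of_exists_le_of_exists_ge hf ⟨1, h1⟩ ⟨0, h0⟩
  exact hne t ht

theorem LinearMap.det_adjoint_eq_det [FiniteDimensional ℝ H] (A : H →ₗ[ℝ] H) :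
    LinearMap.det (LinearMap.adjoint A) = LinearMap.det A := by
  let b := stdOrthonormalBasis ℝ H
  rw [← LinearMap.det_toMatrix b.toBasis, ← LinearMap.det_toMatrix b.toBasis,
    LinearMap.toMatrix_adjoint, Matrix.det_conjTranspose, star_trivial]

theorem inner_complexStructure_map_map (hJ : ∀ x y, ⟪J x, y⟫ = -⟪x, J y⟫) (hJ2 : ∀ x, J (J x) = -x)
    (x y : H) : ⟪J x, J y⟫ = ⟪x, y⟫ := by
  rw [hJ, hJ2, inner_neg_right, neg_neg]

/-- An isometry whose complex-linear part is injective preserves orientation. -/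
theorem det_pos_of_ker_complexLinearPart_eq_bot [FiniteDimensional ℝ H]
    (hJ : ∀ x y, ⟪J x, y⟫ = -⟪x, J y⟫)
    (hJ2 : J * J = -1) (hO : ∀ x y, ⟪O x, O y⟫ = ⟪x, y⟫)
    (hker : LinearMap.ker (O - J * O * J) = ⊥) : 0 < LinearMap.det O := by
  have hJ2' (x : H) : J (J x) = -x := LinearMap.congr_fun hJ2 x
  have hJJ := inner_complexStructure_map_map hJ hJ2'
  have hcomm : Commute (O - J * O * J) J := by
    ext x
    simp [hJ2']
    abel
  have hA : 0 < LinearMap.det (O - J * O * J) :=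
    (LinearMap.det_nonneg_of_commute_complexStructure hJ2 hcomm).lt_of_ne'
      fun h ↦ LinearMap.det_eq_zero_iff_ker_ne_bot.1 h hker
  have hAB (x : H) : ⟪(O - J * O * J) x, (O + J * O * J) x⟫ = 0 := by
    simp only [LinearMap.sub_apply, LinearMap.add_apply, Module.End.mul_apply, inner_sub_left,
      inner_add_right, hJJ, hO]
    linarith [real_inner_comm (O x) (J (O (J x)))]
  have h := LinearMap.det_add_pos_of_inner_eq_zero hAB hA
  have h2 : (O - J * O * J) + (O + J * O * J) = (2 : ℝ) • O := by
    rw [two_smul]; abel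
  rw [h2, LinearMap.det_smul] at h
  exact (mul_pos_iff_of_pos_left (by positivity)).1 h

theorem ker_complexLinearPart_comp_reflection (hJ : ∀ x y, ⟪J x, y⟫ = -⟪x, J y⟫)
    (hJ2 : ∀ x, J (J x) = -x) (hO : ∀ x y, ⟪O x, O y⟫ = ⟪x, y⟫) {v : H} (hv : ‖v‖ = 1)
    (hvK : v ∈ LinearMap.ker (O - J * O * J)) {R : H →ₗ[ℝ] H}
    (hR : ∀ x, R x = x - (2 * ⟪J v, x⟫) • J v) :
    LinearMap.ker (O * R - J * (O * R) * J) =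
      (Submodule.span ℝ (Set.range ![v, J v]))ᗮ ⊓ LinearMap.ker (O - J * O * J) := by
  have hJJ := inner_complexStructure_map_map hJ hJ2
  have hvv : ⟪v, v⟫ = 1 := by rw [real_inner_self_eq_norm_sq, hv, one_pow]
  have hvJ : ⟪v, J v⟫ = 0 := by
    have := hJ v v
    rw [real_inner_comm] at this
    linarith
  have hOv : J (O (J v)) = O v := (sub_eq_zero.1 hvK).symm
  have hOJv : J (O v) = -O (J v) := by rw [← hOv, hJ2]
  have horth (x : H) (a c : ℝ) : ⟪(O - J * O * J) x, O (a • v - c • J v)⟫ = 0 := by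
    have h : O (a • v - c • J v) = J (O (J (a • v - c • J v))) := by
      simp [hJ2, hOv, hOJv, sub_eq_add_neg]
    have h1 : ⟪O x, O (a • v - c • J v)⟫ = ⟪x, a • v - c • J v⟫ := hO _ _
    have h2 : ⟪J (O (J x)), O (a • v - c • J v)⟫ = ⟪x, a • v - c • J v⟫ := by
      rw [h, hJJ, hO, hJJ]
    simp only [LinearMap.sub_apply, Module.End.mul_apply, inner_sub_left]
    rw [h1, h2, sub_self]
  have hformula (x : H) : (O * R - J * (O * R) * J) x =
      (O - J * O * J) x + (2 : ℝ) • O (⟪v, x⟫ • v - ⟪J v, x⟫ • J v) := by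
    simp only [LinearMap.sub_apply, Module.End.mul_apply, hR, map_sub, map_smul, hJJ, hOv]
    module
  have hmem (x : H) : x ∈ (Submodule.span ℝ (Set.range ![v, J v]))ᗮ ↔
      ⟪v, x⟫ = 0 ∧ ⟪J v, x⟫ = 0 := by
    rw [Submodule.mem_orthogonal]
    refine ⟨fun h ↦ ⟨h _ (Submodule.subset_span ⟨0, rfl⟩), h _ (Submodule.subset_span ⟨1, rfl⟩)⟩,
      fun ⟨h0, h1⟩ u hu ↦ ?_⟩
    induction hu using Submodule.span_induction with
    | mem u hu => obtain ⟨i, rfl⟩ := hu; fin_cases i <;> simpa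
    | zero => simp
    | add a b _ _ ha hb => rw [inner_add_left, ha, hb, add_zero]
    | smul r a _ ha => rw [real_inner_smul_left, ha, mul_zero]
  ext x
  rw [Submodule.mem_inf, hmem, LinearMap.mem_ker, LinearMap.mem_ker, hformula]
  constructor
  · intro h
    set y := ⟪v, x⟫ • v - ⟪J v, x⟫ • J v with hy
    have hOy : O y = 0 := by
      have h0 : ⟪(O - J * O * J) x + (2 : ℝ) • O y, O y⟫ = 0 := by rw [h, inner_zero_left]
      rw [inner_add_left, horth, real_inner_smul_left, zero_add] at h0
      simpa using h0
    have hy0 : y = 0 := by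
      have := hO y y
      rwa [hOy, inner_zero_left, eq_comm, inner_self_eq_zero] at this
    refine ⟨⟨?_, ?_⟩, by simpa [hOy] using h⟩
    · have : ⟪v, y⟫ = 0 := by rw [hy0, inner_zero_right]
      simpa only [hy, inner_sub_right, inner_smul_right, hvv, hvJ, mul_one, mul_zero, sub_zero] using this
    · have : ⟪J v, y⟫ = 0 := by rw [hy0, inner_zero_right]
      simpa only [hy, inner_sub_right, inner_smul_right, hJJ, hvv, real_inner_comm v, hvJ, mul_one,
        mul_zero, zero_sub, neg_eq_zero] using this
  · rintro ⟨⟨h0, h1⟩, h⟩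
    simp [h0, h1, h]

/-- The determinant of an isometry has the sign `(-1) ^ k`, where `k` is the complex dimension of
the kernel of its complex-linear part. -/
theorem neg_one_pow_finrank_ker_complexLinearPart_mul_det_pos [FiniteDimensional ℝ H]
    (hJ : ∀ x y, ⟪J x, y⟫ = -⟪x, J y⟫)
    (hJ2 : J * J = -1) (hO : ∀ x y, ⟪O x, O y⟫ = ⟪x, y⟫) :
    0 < (-1 : ℝ) ^ (finrank ℝ (LinearMap.ker (O - J * O * J)) / 2) * LinearMap.det O := by
  have hJ2' (x : H) : J (J x) = -x := LinearMap.congr_fun hJ2 x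
  have hJJ := inner_complexStructure_map_map hJ hJ2'
  induction hn : finrank ℝ (LinearMap.ker (O - J * O * J)) using Nat.strong_induction_on
    generalizing O with
  | _ n ih =>
    by_cases hker : LinearMap.ker (O - J * O * J) = ⊥
    · rw [← hn, hker, finrank_bot]
      simpa using det_pos_of_ker_complexLinearPart_eq_bot hJ hJ2 hO hker
    obtain ⟨u, huK, hu⟩ := Submodule.exists_mem_ne_zero_of_ne_bot hker
    set v : H := ‖u‖⁻¹ • u
    have hv : ‖v‖ = 1 := norm_smul_inv_norm (𝕜 := ℝ) hu
    have hvK : v ∈ LinearMap.ker (O - J * O * J) := Submodule.smul_mem _ _ huK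
    have hvv : ⟪v, v⟫ = 1 := by rw [real_inner_self_eq_norm_sq, hv, one_pow]
    have hJv : ‖J v‖ = 1 := by
      have h := hJJ v v
      rw [hvv, real_inner_self_eq_norm_sq] at h
      exact (pow_eq_one_iff_of_nonneg (norm_nonneg _) two_ne_zero).1 h
    have hvJ : ⟪v, J v⟫ = 0 := by
      have := hJ v v
      rw [real_inner_comm] at this
      linarith
    have hJvK : J v ∈ LinearMap.ker (O - J * O * J) := by
      have h : J (O (J v)) = O v := (sub_eq_zero.1 hvK).symm
      have h' : J (O v) = -O (J v) := by rw [← h, hJ2']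
      simp [hJ2', h']
    let ρ := (Submodule.span ℝ {J v})ᗮ.reflection
    let R : H →ₗ[ℝ] H := ρ.toLinearEquiv.toLinearMap
    have hR (x : H) : R x = x - (2 * ⟪J v, x⟫) • J v := by
      change (Submodule.span ℝ {J v})ᗮ.reflection x = _
      rw [Submodule.reflection_orthogonal_apply, Submodule.reflection_singleton_apply]
      simp [hJv, mul_smul, two_smul]
    have hdetR : LinearMap.det R = -1 := by
      have h : LinearMap.det R = _ := (Submodule.span ℝ {J v})ᗮ.det_reflection
      rw [h, Submodule.orthogonal_orthogonal, finrank_span_singleton, pow_one]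
      rintro h0
      simp [h0] at hJv
    have hOR (x y : H) : ⟪(O * R) x, (O * R) y⟫ = ⟪x, y⟫ := by
      rw [Module.End.mul_apply, Module.End.mul_apply, hO]
      exact ρ.inner_map_map x y
    have hli : LinearIndependent ℝ ![v, J v] := by
      refine Orthonormal.linearIndependent ⟨fun i ↦ ?_, fun i j hij ↦ ?_⟩
      · fin_cases i <;> simpa
      · fin_cases i <;> fin_cases j <;> first | exact absurd rfl hij | simpa [real_inner_comm v] using hvJ
    have hle : Submodule.span ℝ (Set.range ![v, J v]) ≤ LinearMap.ker (O - J * O * J) := by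
      rw [Submodule.span_le]
      rintro _ ⟨i, rfl⟩
      fin_cases i <;> simpa
    have hfin := Submodule.finrank_add_inf_finrank_orthogonal hle
    rw [← ker_complexLinearPart_comp_reflection hJ hJ2' hO hv hvK hR, finrank_span_eq_card hli,
      Fintype.card_fin, hn] at hfin
    have h := ih _ (by omega) hOR rfl
    rw [← hfin, Nat.add_div_left _ (by norm_num), pow_succ]
    rw [map_mul, hdetR] at h
    linarith

end

/-- For a complex structure `J` and an orthogonal operator `O` on a
finite-dimensional real inner product space, `(-1)^{(1/2)dim ker(J + O*JO)} = det O`. -/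
theorem stmt9 {H : Type*} [NormedAddCommGroup H] [InnerProductSpace ℝ H]
    [FiniteDimensional ℝ H]
    (J O : H →ₗ[ℝ] H)
    (hJa : LinearMap.adjoint J = -J) (hJ2 : J * J = -1)
    (hO : LinearMap.adjoint O * O = 1) :
    (-1 : ℝ) ^ (Module.finrank ℝ ↥(LinearMap.ker (J + LinearMap.adjoint O * J * O)) / 2) =
      LinearMap.det O := by
  have hJ (x y : H) : ⟪J x, y⟫ = -⟪x, J y⟫ := by
    rw [← LinearMap.adjoint_inner_right, hJa, LinearMap.neg_apply, inner_neg_right]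
  have hO' (x y : H) : ⟪O x, O y⟫ = ⟪x, y⟫ := by
    rw [← LinearMap.adjoint_inner_right, ← Module.End.mul_apply, hO, Module.End.one_apply]
  have hOO : O * LinearMap.adjoint O = 1 := mul_eq_one_comm.1 hO
  have hfactor : O - J * O * J = (-(J * O)) * (J + LinearMap.adjoint O * J * O) := by
    have : J * O * (LinearMap.adjoint O * J * O) = -O := by
      calc _ = J * (O * LinearMap.adjoint O) * J * O := by simp only [mul_assoc]
        _ = -O := by rw [hOO, mul_one, hJ2, neg_one_mul]
    rw [neg_mul, mul_add, this]
    abel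
  have hinv : LinearMap.adjoint O * J * -(J * O) = 1 := by
    calc _ = -(LinearMap.adjoint O * (J * J) * O) := by simp only [mul_neg, mul_assoc]
      _ = 1 := by rw [hJ2, mul_neg_one, neg_mul, neg_neg, hO]
  have hker : LinearMap.ker (O - J * O * J) =
      LinearMap.ker (J + LinearMap.adjoint O * J * O) := by
    rw [hfactor]
    exact LinearMap.ker_comp_of_ker_eq_bot _ (LinearMap.ker_eq_bot_of_inverse hinv)
  have hpos := neg_one_pow_finrank_ker_complexLinearPart_mul_det_pos hJ hJ2 hO'
  rw [hker] at hpos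
  have hdet : LinearMap.det O * LinearMap.det O = 1 := by
    have h := congrArg LinearMap.det hO
    rw [map_mul, LinearMap.det_adjoint_eq_det, map_one] at h
    exact h
  rcases neg_one_pow_eq_or ℝ (finrank ℝ (LinearMap.ker (J + LinearMap.adjoint O * J * O)) / 2)
    with h | h <;> rcases mul_self_eq_one_iff.1 hdet with h' | h' <;> rw [h, h'] at hpos ⊢ <;>
    norm_num at hpos
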